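/- arXiv:2603.16658 — 3 statements merged into one kernel-verified Lean document; each statement's English description precedes it below -/
import Mathlib

section
/- Schaefer's fixed point theorem: Let E be a real Banach space and let T : E → E be a continuous map that sends bounded subsets of E to relatively compact subsets of E. Suppose there exists a constant M > 0 such that for every λ ∈ [0,1] and every e ∈ E satisfying e = λ • T(e) one has ‖e‖ ≤ M. Then the equation e = T(e) admits at least one solution e ∈ E. -/
open MeasureTheory Filter Topology Polynomial in
/-- A family of functions given by a polynomial in `t` with continuous coefficients has a
polynomial in `t` as its integral over a compact set. -/
theorem exists_polynomial_eval_eq_setIntegral {X : Type*} [TopologicalSpace X] [T2Space X]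
    [MeasurableSpace X] [BorelSpace X] (μ : Measure X) [IsFiniteMeasureOnCompacts μ] {s : Set X}
    (hs : IsCompact s) (p : C(X, ℝ)[X]) :
    ∃ q : ℝ[X], ∀ t : ℝ, q.eval t =
      ∫ x in s, p.eval₂ (ContinuousMap.evalAlgHom ℝ ℝ x : C(X, ℝ) →+* ℝ) t ∂μ := by
  refine ⟨∑ i ∈ p.support, Polynomial.C (∫ x in s, p.coeff i x ∂μ) * Polynomial.X ^ i, fun t => ?_⟩
  simp only [Polynomial.eval₂_eq_sum, Polynomial.sum]
  rw [integral_finsetSum]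
  · simp [Polynomial.eval_finsetSum, integral_mul_const]
  · intro i _
    exact (((p.coeff i).continuous.mul continuous_const).continuousOn).integrableOn_compact hs

section Perturbation

variable {E : Type*} [NormedAddCommGroup E]

theorem bijective_add_smul_of_lipschitzWith [NormedSpace ℝ E] [CompleteSpace E] {g : E → E}
    {K : NNReal} (hg : LipschitzWith K g) {t : ℝ} (ht0 : 0 ≤ t) (ht : t * K < 1) :
    Function.Bijective fun x => x + t • g x := by
  have hlip (y : E) : ContractingWith (t.toNNReal * K) fun x => y - t • g x := by
    refine ⟨?_, LipschitzWith.of_dist_le_mul fun x z => ?_⟩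
    · rw [← NNReal.coe_lt_coe]
      simpa [ht0] using ht
    · rw [dist_sub_left, dist_smul₀]
      have := hg.dist_le_mul x z
      simp only [NNReal.coe_mul, Real.coe_toNNReal _ ht0, Real.norm_eq_abs, abs_of_nonneg ht0,
        mul_assoc]
      gcongr
  refine ⟨fun x z hxz => ?_, fun y => ?_⟩
  · refine (hlip (x + t • g x)).fixedPoint_unique' (x := x) (y := z) ?_ ?_
    · simp [Function.IsFixedPt]
    · simp only at hxz
      simp [Function.IsFixedPt, hxz]
  · have : Nonempty E := ⟨y⟩
    exact ⟨(hlip y).fixedPoint _, (sub_eq_iff_eq_add.1 (hlip y).fixedPoint_isFixedPt).symm⟩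

theorem det_one_add_smul_pos [NormedSpace ℝ E] [FiniteDimensional ℝ E] (A : E →L[ℝ] E) {t : ℝ}
    (ht0 : 0 ≤ t) (ht : t * ‖A‖ < 1) : 0 < (1 + t • A).det := by
  have hne (r : ℝ) (hr : r ∈ Set.Icc 0 t) : (1 + r • A).det ≠ 0 := by
    have : CompleteSpace E := FiniteDimensional.complete ℝ E
    have hu : IsUnit (1 + r • A) := by
      have := isUnit_one_sub_of_norm_lt_one (x := -(r • A)) (by
        rw [norm_neg, norm_smul, Real.norm_eq_abs, abs_of_nonneg hr.1]
        exact (mul_le_mul_of_nonneg_right hr.2 (norm_nonneg _)).trans_lt ht)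
      simpa using this
    have := (hu.map (ContinuousLinearMap.toLinearMapRingHom (R₁ := ℝ) (M₁ := E))).map LinearMap.det
    exact this.ne_zero
  have hcont : Continuous fun r : ℝ => (1 + r • A).det :=
    ContinuousLinearMap.continuous_det.comp (by fun_prop)
  by_contra! h
  obtain ⟨r, hr, hr0⟩ := intermediate_value_Icc' ht0 hcont.continuousOn
    (show (0 : ℝ) ∈ Set.Icc _ _ from ⟨h, by simp [ContinuousLinearMap.det]⟩)
  exact hne r hr hr0

theorem image_add_smul_of_bijective [NormedSpace ℝ E] {g : E → E} {s : Set E}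
    (hs : Function.support g ⊆ s) {t : ℝ} (hb : Function.Bijective fun x => x + t • g x) :
    (fun x => x + t • g x) '' s = s := by
  have hfix : ∀ x ∉ s, x + t • g x = x := fun x hx => by
    simp [Function.notMem_support.1 fun h => hx (hs h)]
  ext y
  constructor
  · rintro ⟨x, hx, rfl⟩
    by_contra hy
    exact hy ((congrArg (· ∈ s) (hb.1 (hfix _ hy))).mpr hx)
  · intro hy
    obtain ⟨x, rfl⟩ := hb.2 y
    refine ⟨x, ?_, rfl⟩
    by_contra hx
    simp only [hfix x hx] at hy
    exact hx hy

end Perturbation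

section Integral

open MeasureTheory Filter Topology Polynomial

variable {E : Type*} [NormedAddCommGroup E] [InnerProductSpace ℝ E] [FiniteDimensional ℝ E]
  [MeasurableSpace E] [BorelSpace E]

theorem exists_polynomial_eval_eq_integral_det {g : E → E} (hg : ContDiff ℝ 1 g) {s : Set E}
    (hs : IsCompact s) (c : ℝ) (m : ℕ) (μ : Measure E) [IsFiniteMeasureOnCompacts μ] :
    ∃ q : ℝ[X], ∀ t : ℝ, q.eval t =
      ∫ x in s, (1 + t • fderiv ℝ g x).det * (c - ‖x + t • g x‖ ^ 2) ^ m ∂μ := by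
  classical
  let b := stdOrthonormalBasis ℝ E
  have hg0 : Continuous g := hg.continuous
  have hg1 : Continuous (fderiv ℝ g) := hg.continuous_fderiv (by simp)
  let A : Matrix _ _ C(E, ℝ)[X] := Matrix.of fun i j =>
    Polynomial.X * Polynomial.C ⟨fun x => inner ℝ (b i) (fderiv ℝ g x (b j)), by fun_prop⟩
  let P : C(E, ℝ)[X] := Polynomial.C ⟨fun x => c - ‖x‖ ^ 2, by fun_prop⟩
    - Polynomial.X * Polynomial.C ⟨fun x => 2 * inner ℝ x (g x), by fun_prop⟩
    - Polynomial.X ^ 2 * Polynomial.C ⟨fun x => ‖g x‖ ^ 2, by fun_prop⟩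
  obtain ⟨q, hq⟩ := exists_polynomial_eval_eq_setIntegral μ hs ((1 + A).det * P ^ m)
  refine ⟨q, fun t => ?_⟩
  rw [hq]
  congr 1 with x
  rw [Polynomial.eval₂_mul, Polynomial.eval₂_pow]
  congr 2
  · rw [← Polynomial.coe_eval₂RingHom, RingHom.map_det, ContinuousLinearMap.det,
      ← LinearMap.det_toMatrix b.toBasis]
    congr 1
    ext i j
    simp only [RingHom.mapMatrix_apply, Matrix.map_apply, Matrix.add_apply, map_add, A,
      LinearMap.toMatrix_apply]
    simp [Matrix.one_apply, OrthonormalBasis.coe_toBasis_repr_apply, b.repr_apply_apply,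
      apply_ite]
    exact mul_comm _ _
  · simp [P, norm_add_sq_real, inner_smul_right, norm_smul, mul_pow]
    ring

theorem integral_det_mul_eq {g : E → E} (hg : ContDiff ℝ 1 g) {s : Set E}
    (hs : IsCompact s) (hgs : tsupport g ⊆ s) (c : ℝ) (m : ℕ) (t : ℝ)
    (μ : Measure E) [μ.IsAddHaarMeasure] :
    ∫ x in s, (1 + t • fderiv ℝ g x).det * (c - ‖x + t • g x‖ ^ 2) ^ m ∂μ =
      ∫ x in s, (c - ‖x‖ ^ 2) ^ m ∂μ := by
  obtain ⟨q, hq⟩ := exists_polynomial_eval_eq_integral_det hg hs c m μ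
  rw [← hq]
  obtain ⟨K, hK⟩ := hg.lipschitzWith_of_hasCompactSupport
    (HasCompactSupport.of_support_subset_isCompact hs ((subset_tsupport g).trans hgs)) (by simp)
  suffices h : q = Polynomial.C (∫ x in s, (c - ‖x‖ ^ 2) ^ m ∂μ) by rw [h, Polynomial.eval_C]
  refine Polynomial.eq_of_infinite_eval_eq _ _
    ((Set.Icc_infinite (show (0 : ℝ) < 1 / (K + 1) by positivity)).mono fun r hr => ?_)
  have hrK : r * K < 1 := by
    have h := hr.2
    rw [le_div_iff₀ (by positivity)] at h
    rcases hr.1.eq_or_lt with rfl | h0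
    · simp
    · linarith
  have hb := bijective_add_smul_of_lipschitzWith hK hr.1 hrK
  have hgd : Differentiable ℝ g := hg.differentiable (by simp)
  have key := integral_image_eq_integral_abs_det_fderiv_smul μ hs.measurableSet
    (f := fun x => x + r • g x) (f' := fun x => 1 + r • fderiv ℝ g x)
    (fun x _ => ((hasFDerivAt_id x).add
      ((hgd x).hasFDerivAt.const_smul r)).hasFDerivWithinAt) hb.1.injOn
    (fun y => (c - ‖y‖ ^ 2) ^ m)
  rw [image_add_smul_of_bijective ((subset_tsupport g).trans hgs) hb] at key
  simp only [Set.mem_ofPred_eq, Polynomial.eval_C]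
  rw [hq, key]
  congr 1 with x
  rw [abs_of_pos (det_one_add_smul_pos _ hr.1 (lt_of_le_of_lt _ hrK)), smul_eq_mul]
  exact mul_le_mul_of_nonneg_left (norm_fderiv_le_of_lipschitz ℝ hK) hr.1

theorem exists_add_eq_zero_of_contDiff {g : E → E} (hg : ContDiff ℝ 1 g)
    (hgc : HasCompactSupport g) : ∃ x, x + g x = 0 := by
  by_contra! hne
  obtain ⟨R, hR0, hR⟩ : ∃ R > 0, tsupport g ⊆ Metric.closedBall (0 : E) R := by
    obtain ⟨R, hR⟩ := hgc.isCompact.isBounded.subset_closedBall (0 : E)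
    exact ⟨max R 1, by positivity, hR.trans (Metric.closedBall_subset_closedBall (le_max_left _ _))⟩
  set s := Metric.closedBall (0 : E) R
  have hs : IsCompact s := isCompact_closedBall _ _
  have hg0 : Continuous g := hg.continuous
  have hg1 : Continuous (fderiv ℝ g) := hg.continuous_fderiv (by simp)
  obtain ⟨x₀, hx₀, hmin⟩ := hs.exists_isMinOn ⟨0, by simp [s, hR0.le]⟩
    (f := fun x => ‖x + g x‖) (by fun_prop)
  obtain ⟨C, hC⟩ := hs.exists_bound_of_continuousOn
    (f := fun x => x + g x) (by fun_prop)
  have hdet : Continuous fun x => (1 + fderiv ℝ g x).det :=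
    ContinuousLinearMap.continuous_det.comp (by fun_prop)
  obtain ⟨D, hD⟩ := hs.exists_bound_of_continuousOn hdet.continuousOn
  set ε := ‖x₀ + g x₀‖
  have hε : 0 < ε := norm_pos_iff.2 (hne x₀)
  set δ := min (ε / 2) R
  have hδ : 0 < δ := by positivity
  have hδε : δ < ε := (min_le_left _ _).trans_lt (by linarith)
  let c := C ^ 2 + R ^ 2
  have hεC : ε ≤ C := hC x₀ hx₀
  have hc : 0 ≤ c - ε ^ 2 := by simp only [c]; nlinarith
  have hlt : c - ε ^ 2 < c - δ ^ 2 := by nlinarith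
  let v := volume.real s
  let w := volume.real (Metric.closedBall (0 : E) δ)
  have hw : 0 < w := by
    refine ENNReal.toReal_pos (Metric.measure_closedBall_pos _ _ hδ).ne'
      (isCompact_closedBall _ _).measure_lt_top.ne
  have bound (m : ℕ) : (c - δ ^ 2) ^ m * w ≤ D * (c - ε ^ 2) ^ m * v := by
    have key := integral_det_mul_eq hg hs hR c m 1 volume
    simp only [one_smul] at key
    calc (c - δ ^ 2) ^ m * w
        = ∫ x in Metric.closedBall (0 : E) δ, (c - δ ^ 2) ^ m := by
          simp [w, mul_comm]
      _ ≤ ∫ x in Metric.closedBall (0 : E) δ, (c - ‖x‖ ^ 2) ^ m := by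
          refine setIntegral_mono_on
            (continuousOn_const.integrableOn_compact (isCompact_closedBall _ _))
            (ContinuousOn.integrableOn_compact (isCompact_closedBall _ _) (by fun_prop))
            measurableSet_closedBall fun x hx => ?_
          rw [mem_closedBall_zero_iff] at hx
          gcongr
          exact hc.trans hlt.le
      _ ≤ ∫ x in s, (c - ‖x‖ ^ 2) ^ m := by
          refine setIntegral_mono_set (ContinuousOn.integrableOn_compact hs (by fun_prop)) ?_
            (Metric.closedBall_subset_closedBall (min_le_right _ _)).eventuallyLE
          refine (ae_restrict_iff' hs.measurableSet).2 (.of_forall fun x hx => pow_nonneg ?_ m)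
          rw [mem_closedBall_zero_iff] at hx
          have : ‖x‖ ^ 2 ≤ R ^ 2 := by gcongr
          simp only [c]
          nlinarith
      _ = ∫ x in s, (1 + fderiv ℝ g x).det * (c - ‖x + g x‖ ^ 2) ^ m := key.symm
      _ ≤ ‖∫ x in s, (1 + fderiv ℝ g x).det * (c - ‖x + g x‖ ^ 2) ^ m‖ := Real.le_norm_self _
      _ ≤ D * (c - ε ^ 2) ^ m * v := by
          refine norm_setIntegral_le_of_norm_le_const hs.measure_lt_top fun x hx => ?_
          have h1 : ‖x + g x‖ ^ 2 ≤ C ^ 2 := by gcongr; exact hC x hx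
          have h2 : ε ^ 2 ≤ ‖x + g x‖ ^ 2 := by gcongr; exact hmin hx
          have h3 : 0 ≤ c - ‖x + g x‖ ^ 2 := by simp only [c]; nlinarith
          rw [norm_mul, norm_pow, Real.norm_of_nonneg h3]
          have := hD x hx
          have hD0 : 0 ≤ D := (norm_nonneg _).trans this
          gcongr
  have hpos : 0 < c - δ ^ 2 := hc.trans_lt hlt
  have hlim : Tendsto (fun m : ℕ => D * v * ((c - ε ^ 2) / (c - δ ^ 2)) ^ m) atTop (𝓝 0) := by
    simpa using (tendsto_pow_atTop_nhds_zero_of_lt_one (div_nonneg hc hpos.le)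
      ((div_lt_one hpos).2 hlt)).const_mul (D * v)
  refine hw.not_ge (ge_of_tendsto' hlim fun m => ?_)
  rw [div_pow, ← mul_div_assoc, le_div_iff₀ (by positivity)]
  linarith [bound m]

end Integral

section FixedPoint

open Filter Topology

theorem exists_fixedPoint_of_hasCompactSupport {E : Type*} [NormedAddCommGroup E]
    [InnerProductSpace ℝ E] [FiniteDimensional ℝ E] {f : E → E} (hf : Continuous f)
    (hfc : HasCompactSupport f) : ∃ x, f x = x := by
  borelize E
  by_contra! hne
  obtain ⟨x₀, hx₀⟩ : ∃ x₀, ∀ x ∈ insert 0 (tsupport f), ‖f x₀ - x₀‖ ≤ ‖f x - x‖ :=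
    let ⟨x₀, _, h⟩ := (hfc.isCompact.insert 0).exists_isMinOn (Set.insert_nonempty _ _)
      (f := fun x => ‖f x - x‖) (by fun_prop)
    ⟨x₀, fun x hx => h hx⟩
  have hpos : 0 < ‖f x₀ - x₀‖ := norm_pos_iff.2 (sub_ne_zero.2 (hne x₀))
  obtain ⟨g, hg, hgf, hsupp⟩ := hf.exists_contDiff_approx 1 (ε := fun _ => ‖f x₀ - x₀‖)
    continuous_const fun _ => hpos
  have hgc : HasCompactSupport fun x => -g x :=
    (hfc.mono hsupp).neg
  obtain ⟨x, hx⟩ := exists_add_eq_zero_of_contDiff (g := fun x => -g x) hg.neg hgc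
  have hx : g x = x := (add_neg_eq_zero.1 hx).symm
  have hlt := hgf x
  rw [hx, dist_eq_norm, norm_sub_rev] at hlt
  refine hlt.not_ge (hx₀ x ?_)
  by_cases h : x = 0
  · exact Or.inl h
  · exact Or.inr (subset_tsupport f (hsupp (by rwa [Function.mem_support, hx])))

/-- **Brouwer's fixed point theorem** for bounded continuous self-maps of a Euclidean space. -/
theorem exists_fixedPoint_of_bounded_of_innerProductSpace {E : Type*} [NormedAddCommGroup E]
    [InnerProductSpace ℝ E] [FiniteDimensional ℝ E] {f : E → E} (hf : Continuous f) {R : ℝ}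
    (hR : ∀ x, ‖f x‖ ≤ R) : ∃ x, f x = x := by
  obtain ⟨χ, hχ1, -, hχc, hχ⟩ := exists_continuous_one_zero_of_isCompact
    (isCompact_closedBall (0 : E) R) isClosed_empty (Set.disjoint_empty _)
  obtain ⟨x, hx⟩ := exists_fixedPoint_of_hasCompactSupport (f := fun x => χ x • f x)
    (by fun_prop) (hχc.smul_right)
  refine ⟨x, ?_⟩
  have hmem : x ∈ Metric.closedBall (0 : E) R := by
    rw [mem_closedBall_zero_iff, ← hx, norm_smul, Real.norm_of_nonneg (hχ x).1]
    exact (mul_le_of_le_one_left (norm_nonneg _) (hχ x).2).trans (hR x)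
  simpa [hχ1 hmem] using hx

/-- **Brouwer's fixed point theorem** for bounded continuous self-maps of a finite-dimensional
normed space. -/
theorem exists_fixedPoint_of_bounded {F : Type*} [NormedAddCommGroup F] [NormedSpace ℝ F]
    [FiniteDimensional ℝ F] {f : F → F} (hf : Continuous f) {R : ℝ} (hR : ∀ x, ‖f x‖ ≤ R) :
    ∃ x, f x = x := by
  let e : F ≃L[ℝ] EuclideanSpace ℝ (Fin (Module.finrank ℝ F)) := toEuclidean
  obtain ⟨x, hx⟩ := exists_fixedPoint_of_bounded_of_innerProductSpace
    (f := fun y => e (f (e.symm y))) (by fun_prop)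
    (R := ‖(e : F →L[ℝ] EuclideanSpace ℝ (Fin (Module.finrank ℝ F)))‖ * R) fun y =>
      ((e : F →L[ℝ] EuclideanSpace ℝ (Fin (Module.finrank ℝ F))).le_opNorm _).trans
        (mul_le_mul_of_nonneg_left (hR _) (norm_nonneg _))
  exact ⟨e.symm x, e.injective (by simpa using hx)⟩

variable {E : Type*} [NormedAddCommGroup E] [NormedSpace ℝ E]

/-- The Schauder projection: on a compact set, the identity is uniformly approximated by continuous
maps into the convex hull of a finite set. -/
theorem IsCompact.exists_continuousOn_convexHull_approx {K : Set E} (hK : IsCompact K) {ε : ℝ}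
    (hε : 0 < ε) : ∃ (t : Finset E) (p : E → E), ContinuousOn p K ∧
      ∀ x ∈ K, p x ∈ convexHull ℝ (t : Set E) ∧ dist (p x) x < ε := by
  obtain ⟨u, -, ht', hcov⟩ := hK.finite_cover_balls hε
  lift u to Finset E using ht'
  let w (y x : E) : ℝ := max 0 (ε - dist y x)
  have hw (y x : E) : 0 ≤ w y x := le_max_left _ _
  have hwpos (y x : E) (h : w y x ≠ 0) : dist y x < ε := by
    by_contra! h'
    exact h (max_eq_left (by linarith))
  have hpos : ∀ x ∈ K, 0 < ∑ y ∈ u, w y x := fun x hx => by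
    obtain ⟨y, hy, hxy⟩ := Set.mem_iUnion₂.1 (hcov hx)
    refine Finset.sum_pos' (fun y _ => hw y x) ⟨y, hy, lt_max_of_lt_right ?_⟩
    rw [Metric.mem_ball'] at hxy
    linarith
  refine ⟨u, fun x => u.centerMass (fun y => w y x) id, ?_, fun x hx => ⟨?_, ?_⟩⟩
  · simp only [Finset.centerMass, w]
    exact ContinuousOn.smul (ContinuousOn.inv₀ (by fun_prop) fun x hx => (hpos x hx).ne')
      (by fun_prop)
  · exact Finset.centerMass_mem_convexHull _ (fun y _ => hw y x) (hpos x hx) fun y hy => hy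
  · beta_reduce
    rw [← Metric.mem_ball, ← Finset.centerMass_filter_ne_zero]
    refine (convex_ball x ε).centerMass_mem (fun y _ => hw y x) ?_ fun y hy => ?_
    · rw [Finset.sum_filter_ne_zero]
      exact hpos x hx
    · exact hwpos y x (Finset.mem_filter.1 hy).2

/-- **Schauder's fixed point theorem** for continuous self-maps with relatively compact range. -/
theorem exists_fixedPoint_of_forall_mem_isCompact {f : E → E} (hf : Continuous f) {K : Set E}
    (hK : IsCompact K) (hfK : ∀ x, f x ∈ K) : ∃ x, f x = x := by
  have approx (ε : ℝ) (hε : 0 < ε) : ∃ x, dist x (f x) < ε := by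
    obtain ⟨t, p, hp, hpK⟩ := hK.exists_continuousOn_convexHull_approx hε
    let F := Submodule.span ℝ (t : Set E)
    have hF (x : E) : p (f x) ∈ F :=
      convexHull_min Submodule.subset_span F.convex (hpK _ (hfK x)).1
    obtain ⟨R, hR⟩ := (isBounded_convexHull.2 t.finite_toSet.isBounded).exists_norm_le
    obtain ⟨x, hx⟩ := exists_fixedPoint_of_bounded (f := fun x : F => (⟨p (f x), hF x⟩ : F))
      ((hp.comp_continuous (hf.comp continuous_subtype_val) fun x => hfK x.1).subtype_mk _)
      (R := R) fun x => hR _ (hpK _ (hfK x)).1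
    refine ⟨x, ?_⟩
    have := (hpK _ (hfK x)).2
    rwa [show p (f x) = x from congrArg Subtype.val hx] at this
  choose x hx using fun n : ℕ => approx (1 / (n + 1)) Nat.one_div_pos_of_nat
  obtain ⟨a, -, φ, hφ, ha⟩ := hK.tendsto_subseq fun n => hfK (x n)
  have hdist : Tendsto (fun n => dist (x (φ n)) (f (x (φ n)))) atTop (𝓝 0) :=
    (squeeze_zero (fun _ => dist_nonneg) (fun n => (hx n).le)
      tendsto_one_div_add_atTop_nhds_zero_nat).comp hφ.tendsto_atTop
  have hxa : Tendsto (fun n => x (φ n)) atTop (𝓝 a) :=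
    (tendsto_iff_of_dist hdist).2 ha
  exact ⟨a, tendsto_nhds_unique ((hf.tendsto a).comp hxa) ha⟩

end FixedPoint

/-- Schaefer's fixed point theorem: if `T : E → E` is continuous on a real Banach
space `E`, maps bounded sets to relatively compact sets, and there is `M > 0` such
that every solution of `e = λ • T e` with `λ ∈ [0,1]` satisfies `‖e‖ ≤ M`, then
`T` has a fixed point. -/
theorem schaefer_fixed_point {E : Type*} [NormedAddCommGroup E] [NormedSpace ℝ E]
    [CompleteSpace E] (T : E → E) (hT_cont : Continuous T)
    (hT_cpt : ∀ s : Set E, Bornology.IsBounded s → IsCompact (closure (T '' s)))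
    (M : ℝ) (hM : 0 < M)
    (hbound : ∀ l : ℝ, l ∈ Set.Icc (0 : ℝ) 1 → ∀ e : E, e = l • T e → ‖e‖ ≤ M) :
    ∃ e : E, e = T e := by
  set R := M + 1 with hRdef
  have hR : 0 < R := by positivity
  let a (x : E) : ℝ := R / max R ‖x‖
  have ha1 (x : E) : a x ∈ Set.Icc (0 : ℝ) 1 :=
    ⟨by positivity, (div_le_one (by positivity)).2 (le_max_left _ _)⟩
  have ha_eq (x : E) (hx : ‖x‖ ≤ R) : a x = 1 := by
    simp only [a, max_eq_left hx, div_self hR.ne']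
  have hnorm (x : E) : ‖a x • x‖ ≤ R := by
    rw [norm_smul, Real.norm_of_nonneg (ha1 x).1, div_mul_eq_mul_div, div_le_iff₀ (by positivity)]
    gcongr
    exact le_max_right _ _
  have ha_cont : Continuous fun x => a x • x :=
    (continuous_const.div (by fun_prop) fun x => (lt_max_of_lt_left hR).ne').smul continuous_id
  have hK := (hT_cpt _ (Metric.isBounded_closedBall (x := (0 : E)) (r := R))).image ha_cont
  obtain ⟨x, hx⟩ := exists_fixedPoint_of_forall_mem_isCompact
    (ha_cont.comp (hT_cont.comp ha_cont)) hK fun x =>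
      ⟨_, subset_closure ⟨_, mem_closedBall_zero_iff.2 (hnorm x), rfl⟩, rfl⟩
  simp only [Function.comp_apply] at hx
  have hxR : ‖x‖ ≤ R := hx ▸ hnorm _
  rw [ha_eq x hxR, one_smul] at hx
  have hxM : ‖x‖ ≤ M := hbound _ (ha1 (T x)) x hx.symm
  refine ⟨x, ?_⟩
  by_cases hT : ‖T x‖ ≤ R
  · rw [ha_eq _ hT, one_smul] at hx
    exact hx.symm
  · push Not at hT
    have : ‖x‖ = R := by
      rw [← hx, norm_smul, Real.norm_of_nonneg (ha1 _).1]
      simp only [a, max_eq_right hT.le]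
      exact div_mul_cancel₀ _ (hR.trans hT).ne'
    linarith
end

section
/- Morrey's inequality on ℝ³: Let p be a real number with p > 3, and let φ : ℝ³ → ℝ be continuously differentiable with ‖∇φ‖ ∈ L^p(ℝ³), i.e. (∫_{ℝ³} ‖∇φ(x)‖^p dx)^{1/p} < ∞. Set σ := 1 − 3/p. Then there exists a constant C > 0, depending only on p, such that for all x, y ∈ ℝ³ one has |φ(x) − φ(y)| ≤ C · (∫_{ℝ³} ‖∇φ(z)‖^p dz)^{1/p} · ‖x − y‖^σ. -/
open MeasureTheory Set Module
open scoped ENNReal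

section Morrey

variable {E : Type*} [NormedAddCommGroup E] [NormedSpace ℝ E]

/-- The increment of a `C¹` function is bounded by the integral of its derivative over a segment. -/
lemma enorm_sub_le_lintegral_fderiv_segment {φ : E → ℝ} (hφ : ContDiff ℝ 1 φ) (w z : E) :
    ‖φ z - φ w‖ₑ ≤ ∫⁻ t in Ioc (0 : ℝ) 1, ‖fderiv ℝ φ (w + t • (z - w))‖ₑ * ‖z - w‖ₑ := by
  have hline : ∀ t : ℝ, HasDerivAt (fun t : ℝ => w + t • (z - w)) (z - w) t := fun t => by
    simpa using ((hasDerivAt_id t).smul_const (z - w)).const_add w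
  have hcomp : ContDiff ℝ 1 (fun t : ℝ => φ (w + t • (z - w))) := hφ.comp (by fun_prop)
  have h := enorm_sub_le_lintegral_deriv_of_contDiffOn_Icc hcomp.contDiffOn (zero_le_one' ℝ)
  simp only [one_smul, zero_smul, add_zero, add_sub_cancel] at h
  rw [restrict_Ioc_eq_restrict_Icc]
  refine h.trans (lintegral_mono fun t => ?_)
  have hd := ((hφ.differentiable one_ne_zero _).hasFDerivAt).comp_hasDerivAt t (hline t)
  rw [show deriv (fun t : ℝ => φ (w + t • (z - w))) t = _ from hd.deriv]
  exact ContinuousLinearMap.le_opENorm _ _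

lemma lintegral_Ioc_ofReal_rpow {a : ℝ} (ha : -1 < a) :
    ∫⁻ t in Ioc (0 : ℝ) 1, ENNReal.ofReal (t ^ a) = ENNReal.ofReal (1 / (a + 1)) := by
  rw [← ofReal_integral_eq_lintegral_ofReal
    (intervalIntegral.intervalIntegrable_rpow' ha).1
    (ae_restrict_of_forall_mem measurableSet_Ioc fun t ht => Real.rpow_nonneg ht.1.le a),
    ← intervalIntegral.integral_of_le zero_le_one, integral_rpow (Or.inl ha)]
  simp [Real.zero_rpow (show a + 1 ≠ 0 by linarith)]

variable [FiniteDimensional ℝ E] [MeasurableSpace E] [BorelSpace E]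
  (μ : Measure E) [μ.IsAddHaarMeasure]

lemma lintegral_comp_add_smul_sub {f : E → ℝ≥0∞} (hf : Measurable f) (w : E) {t : ℝ}
    (ht : 0 < t) :
    ∫⁻ z, f (w + t • (z - w)) ∂μ = ENNReal.ofReal ((t ^ finrank ℝ E)⁻¹) * ∫⁻ z, f z ∂μ := by
  rw [lintegral_sub_right_eq_self (μ := μ) (fun z => f (w + t • z)) w,
    ← lintegral_map (f := fun z => f (w + z)) (g := fun z => t • z) (by fun_prop) (by fun_prop),
    Measure.map_addHaar_smul μ ht.ne', lintegral_smul_measure,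
    lintegral_add_left_eq_self (μ := μ) f w, abs_of_pos (by positivity), smul_eq_mul]

/-- Averaging a function over the contraction of a set with ratio `t` costs a factor
`t ^ (-n / p)` in terms of its `L^p` norm. -/
lemma setLIntegral_comp_add_smul_sub_le {p : ℝ} (hp : 1 < p) {f : E → ℝ≥0∞} (hf : Measurable f)
    (B : Set E) (w : E) {t : ℝ} (ht : 0 < t) :
    ∫⁻ z in B, f (w + t • (z - w)) ∂μ ≤
      ENNReal.ofReal (t ^ (-(finrank ℝ E / p))) *
        ((∫⁻ z, f z ^ p ∂μ) ^ (1 / p) * μ B ^ (1 - 1 / p)) := by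
  have hp0 : 0 < p := by linarith
  have hpq := Real.HolderConjugate.conjExponent hp
  have h := ENNReal.lintegral_mul_le_Lp_mul_Lq (μ.restrict B) hpq
    (f := fun z => f (w + t • (z - w))) (g := 1) (by fun_prop) aemeasurable_const
  simp only [mul_one, Pi.one_apply, ENNReal.one_rpow, lintegral_const, Measure.restrict_apply_univ,
    one_mul] at h
  have hq : 1 / p.conjExponent = 1 - 1 / p := by
    rw [one_div, one_div, eq_sub_iff_add_eq', hpq.inv_add_inv_eq_one]
  rw [hq] at h
  have hscale : ENNReal.ofReal (t ^ (-(finrank ℝ E / p))) =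
      ENNReal.ofReal ((t ^ finrank ℝ E)⁻¹) ^ (1 / p) := by
    rw [ENNReal.ofReal_rpow_of_pos (by positivity), ← Real.rpow_natCast, ← Real.rpow_neg ht.le,
      ← Real.rpow_mul ht.le]
    congr 2
    ring
  rw [← mul_assoc, hscale, ← ENNReal.mul_rpow_of_nonneg _ _ (by positivity),
    ← lintegral_comp_add_smul_sub μ (f := fun z => f z ^ p) (by fun_prop) w ht]
  refine h.trans ?_
  gcongr
  exact Measure.restrict_le_self

/-- The mean oscillation of a `C¹` function around a point is controlled by the `L^p` norm of its
derivative. -/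
lemma setLIntegral_enorm_sub_le {p : ℝ} (hp1 : 1 < p) (hp : finrank ℝ E < p) {φ : E → ℝ}
    (hφ : ContDiff ℝ 1 φ) {B : Set E} (hB : MeasurableSet B) (w : E) {d : ℝ≥0∞}
    (hd : ∀ z ∈ B, ‖z - w‖ₑ ≤ d) :
    ∫⁻ z in B, ‖φ z - φ w‖ₑ ∂μ ≤
      ENNReal.ofReal (1 / (1 - finrank ℝ E / p)) *
        ((∫⁻ z, ‖fderiv ℝ φ z‖ₑ ^ p ∂μ) ^ (1 / p) * μ B ^ (1 - 1 / p)) * d := by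
  have hcont : Continuous (fderiv ℝ φ) := hφ.continuous_fderiv one_ne_zero
  have hmeas : Measurable fun z => ‖fderiv ℝ φ z‖ₑ := hcont.enorm.measurable
  have ha : -1 < -(finrank ℝ E / p) := by
    rw [neg_lt_neg_iff, div_lt_one (by linarith)]; exact hp
  have hjoint : Measurable (Function.uncurry fun (z : E) (t : ℝ) =>
      ‖fderiv ℝ φ (w + t • (z - w))‖ₑ) :=
    Continuous.measurable (hcont.comp (by fun_prop)).enorm
  calc ∫⁻ z in B, ‖φ z - φ w‖ₑ ∂μ
      ≤ ∫⁻ z in B, (∫⁻ t in Ioc (0 : ℝ) 1, ‖fderiv ℝ φ (w + t • (z - w))‖ₑ) * d ∂μ := by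
        refine setLIntegral_mono' hB fun z hz => ?_
        refine (enorm_sub_le_lintegral_fderiv_segment hφ w z).trans ?_
        rw [lintegral_mul_const _ (by fun_prop)]
        gcongr
        exact hd z hz
    _ = (∫⁻ t in Ioc (0 : ℝ) 1, ∫⁻ z in B, ‖fderiv ℝ φ (w + t • (z - w))‖ₑ ∂μ) * d := by
        rw [lintegral_mul_const _ hjoint.lintegral_prod_right,
          lintegral_lintegral_swap hjoint.aemeasurable]
    _ ≤ (∫⁻ t in Ioc (0 : ℝ) 1, ENNReal.ofReal (t ^ (-(finrank ℝ E / p))) *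
          ((∫⁻ z, ‖fderiv ℝ φ z‖ₑ ^ p ∂μ) ^ (1 / p) * μ B ^ (1 - 1 / p))) * d := by
        gcongr ?_ * d
        exact setLIntegral_mono' measurableSet_Ioc fun t ht =>
          setLIntegral_comp_add_smul_sub_le μ hp1 hmeas B w ht.1
    _ = _ := by
        rw [lintegral_mul_const _ (by fun_prop), lintegral_Ioc_ofReal_rpow ha, neg_add_eq_sub]

/-- Morrey's inequality for `C¹` functions on a finite-dimensional normed space. -/
theorem abs_sub_le_of_integrable_fderiv_rpow {p : ℝ} (hp1 : 1 < p) (hp : finrank ℝ E < p)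
    {φ : E → ℝ} (hφ : ContDiff ℝ 1 φ) (hint : Integrable (fun z => ‖fderiv ℝ φ z‖ ^ p) μ)
    (x y : E) :
    |φ x - φ y| ≤ 4 / (1 - finrank ℝ E / p) * μ.real (Metric.ball 0 1) ^ (-(1 / p)) *
      (∫ z, ‖fderiv ℝ φ z‖ ^ p ∂μ) ^ (1 / p) * ‖x - y‖ ^ (1 - finrank ℝ E / p) := by
  have hp0 : 0 < p := by linarith
  set n := finrank ℝ E with hn
  have hσ : 0 < 1 - n / p := by rw [sub_pos, div_lt_one hp0]; exact hp
  rcases eq_or_ne x y with rfl | hxy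
  · simp [Real.zero_rpow hσ.ne']
  set r := ‖x - y‖ with hr_def
  have hr : 0 < r := norm_pos_iff.2 (sub_ne_zero.2 hxy)
  set B := Metric.closedBall x r with hB_def
  have hBm : MeasurableSet B := Metric.isClosed_closedBall.measurableSet
  have hB_top : μ B ≠ ∞ := measure_closedBall_lt_top.ne
  have hy : y ∈ B := by rw [hB_def, Metric.mem_closedBall, dist_comm, dist_eq_norm]
  have hx : x ∈ B := Metric.mem_closedBall_self hr.le
  have hdist : ∀ w ∈ B, ∀ z ∈ B, ‖z - w‖ₑ ≤ ENNReal.ofReal (2 * r) := fun w hw z hz => by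
    rw [← ofReal_norm, ← dist_eq_norm]
    apply ENNReal.ofReal_le_ofReal
    linarith [dist_triangle_right z w x, Metric.mem_closedBall.1 hw, Metric.mem_closedBall.1 hz]
  set I := ∫ z, ‖fderiv ℝ φ z‖ ^ p ∂μ with hI_def
  have hI : 0 ≤ I := integral_nonneg fun z => by positivity
  have hlint : ∫⁻ z, ‖fderiv ℝ φ z‖ₑ ^ p ∂μ = ENNReal.ofReal I := by
    rw [hI_def, ofReal_integral_eq_lintegral_ofReal hint (ae_of_all _ fun z => by positivity)]
    refine lintegral_congr fun z => ?_
    rw [← ofReal_norm, ENNReal.ofReal_rpow_of_nonneg (norm_nonneg _) hp0.le]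
  set V := μ.real (Metric.ball (0 : E) 1) with hV_def
  have hV : 0 < V :=
    ENNReal.toReal_pos (Metric.measure_ball_pos μ 0 one_pos).ne' measure_ball_lt_top.ne
  have hB : μ B = ENNReal.ofReal (r ^ n * V) := by
    rw [hB_def, Measure.addHaar_closedBall μ x hr.le, ENNReal.ofReal_mul (by positivity), hV_def,
      ofReal_measureReal measure_ball_lt_top.ne]
  have hosc : ∀ w ∈ B, ∫⁻ z in B, ‖φ z - φ w‖ₑ ∂μ ≤ ENNReal.ofReal
      (1 / (1 - n / p) * (I ^ (1 / p) * (r ^ n * V) ^ (1 - 1 / p)) * (2 * r)) := fun w hw => by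
    have h := setLIntegral_enorm_sub_le μ hp1 hp hφ hBm w (hdist w hw)
    rwa [hlint, hB, ENNReal.ofReal_rpow_of_nonneg hI (by positivity),
      ENNReal.ofReal_rpow_of_pos (by positivity), ← ENNReal.ofReal_mul (by positivity),
      ← ENNReal.ofReal_mul (by positivity), ← ENNReal.ofReal_mul (by positivity)] at h
  have hmain : ENNReal.ofReal (|φ x - φ y| * (r ^ n * V)) ≤ ENNReal.ofReal
      (2 * (1 / (1 - n / p) * (I ^ (1 / p) * (r ^ n * V) ^ (1 - 1 / p)) * (2 * r))) := by
    calc ENNReal.ofReal (|φ x - φ y| * (r ^ n * V))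
        = ∫⁻ z in B, ‖φ x - φ y‖ₑ ∂μ := by
          rw [ENNReal.ofReal_mul (abs_nonneg _), ← hB, setLIntegral_const, ← Real.norm_eq_abs,
            ofReal_norm]
      _ ≤ ∫⁻ z in B, (‖φ z - φ x‖ₑ + ‖φ z - φ y‖ₑ) ∂μ := by
          refine lintegral_mono fun z => ?_
          simp only [← edist_eq_enorm_sub]
          exact edist_triangle_left _ _ _
      _ = ∫⁻ z in B, ‖φ z - φ x‖ₑ ∂μ + ∫⁻ z in B, ‖φ z - φ y‖ₑ ∂μ :=
          lintegral_add_left ((hφ.continuous.sub continuous_const).enorm.measurable) _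
      _ ≤ _ := by
          rw [two_mul, ENNReal.ofReal_add (by positivity) (by positivity)]
          exact add_le_add (hosc x hx) (hosc y hy)
  rw [ENNReal.ofReal_le_ofReal_iff (by positivity)] at hmain
  have hsplit : (r ^ n * V) ^ (1 - 1 / p) * r =
      V ^ (-(1 / p)) * r ^ (1 - n / p) * (r ^ n * V) := by
    rw [sub_eq_add_neg 1 (1 / p), Real.rpow_add (by positivity), Real.rpow_one,
      Real.mul_rpow (by positivity) hV.le, ← Real.rpow_natCast r n, ← Real.rpow_mul hr.le,
      show 1 - n / p = 1 + n * -(1 / p) by ring, Real.rpow_add hr, Real.rpow_one]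
    ring
  refine le_of_mul_le_mul_right (hmain.trans_eq ?_) (show 0 < r ^ n * V by positivity)
  linear_combination (4 / (1 - n / p) * I ^ (1 / p)) * hsplit

end Morrey

/-- Morrey's inequality on `ℝ³`: a `C¹` function whose gradient is in `L^p`
with `p > 3` is `(1 - 3/p)`-Hölder continuous. -/
theorem morrey_inequality_R3 (p : ℝ) (hp : 3 < p) :
    ∃ C > 0, ∀ φ : EuclideanSpace ℝ (Fin 3) → ℝ, ContDiff ℝ 1 φ →
      Integrable (fun x => ‖fderiv ℝ φ x‖ ^ p) →
      ∀ x y : EuclideanSpace ℝ (Fin 3),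
        |φ x - φ y| ≤
          C * (∫ z, ‖fderiv ℝ φ z‖ ^ p) ^ (1 / p) * ‖x - y‖ ^ (1 - 3 / p) := by
  have hσ : 0 < 1 - 3 / p := by rw [sub_pos, div_lt_one (by linarith)]; exact hp
  have hV : 0 < volume.real (Metric.ball (0 : EuclideanSpace ℝ (Fin 3)) 1) :=
    ENNReal.toReal_pos (Metric.measure_ball_pos volume 0 one_pos).ne'
      measure_ball_lt_top.ne
  refine ⟨4 / (1 - 3 / p) *
    volume.real (Metric.ball (0 : EuclideanSpace ℝ (Fin 3)) 1) ^ (-(1 / p)), by positivity,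
    fun φ hφ hint x y => ?_⟩
  simpa using abs_sub_le_of_integrable_fderiv_rpow volume (by linarith) (by simpa using hp)
    hφ hint x y
end

section
/- Product law Ḣ¹ × Ḣ¹ → Ḣ^{1/2} in ℝ³, Fourier-convolution form: There exists a constant C > 0 such that for all measurable functions F, G : ℝ³ → [0,∞] one has ∫_{ℝ³} ‖ξ‖ · ( ∫_{ℝ³} F(ξ−η) G(η) dη )² dξ ≤ C · ( ∫_{ℝ³} ‖ξ‖² F(ξ)² dξ ) · ( ∫_{ℝ³} ‖ξ‖² G(ξ)² dξ ), where all integrals are Lebesgue integrals of nonnegative functions valued in [0,∞]. -/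
open MeasureTheory ENNReal

/-- The Cauchy-Schwarz inequality for the Lebesgue integral of `ℝ≥0∞`-valued functions. -/
lemma sq_lintegral_mul_le {α : Type*} [MeasurableSpace α] {μ : Measure α} {f g : α → ℝ≥0∞}
    (hf : AEMeasurable f μ) (hg : AEMeasurable g μ) :
    (∫⁻ a, f a * g a ∂μ) ^ 2 ≤ (∫⁻ a, f a ^ 2 ∂μ) * ∫⁻ a, g a ^ 2 ∂μ := by
  have h := ENNReal.lintegral_mul_le_Lp_mul_Lq μ Real.HolderConjugate.two_two hf hg
  have hsq : ∀ x : ℝ≥0∞, (x ^ (1 / 2 : ℝ)) ^ 2 = x := fun x ↦ by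
    rw [← ENNReal.rpow_natCast, ← ENNReal.rpow_mul]
    norm_num
  calc (∫⁻ a, f a * g a ∂μ) ^ 2
      ≤ ((∫⁻ a, f a ^ (2 : ℝ) ∂μ) ^ (1 / 2 : ℝ) * (∫⁻ a, g a ^ (2 : ℝ) ∂μ) ^ (1 / 2 : ℝ)) ^ 2 := by
        gcongr
        exact h
    _ = (∫⁻ a, f a ^ 2 ∂μ) * ∫⁻ a, g a ^ 2 ∂μ := by
        simp only [mul_pow, hsq, ENNReal.rpow_two]

/-- The integral of a convolution is the product of the integrals. -/
lemma lintegral_lintegral_sub_mul {E : Type*} [AddCommGroup E] [MeasurableSpace E]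
    [MeasurableAdd₂ E] [MeasurableSub₂ E] {μ : Measure E} [SFinite μ] [μ.IsAddRightInvariant]
    {f g : E → ℝ≥0∞} (hf : Measurable f) (hg : Measurable g) :
    ∫⁻ x, ∫⁻ y, f (x - y) * g y ∂μ ∂μ = (∫⁻ x, f x ∂μ) * ∫⁻ y, g y ∂μ := by
  rw [lintegral_lintegral_swap (by fun_prop), ← lintegral_const_mul _ hg]
  refine lintegral_congr fun y ↦ ?_
  rw [lintegral_mul_const _ (by fun_prop), lintegral_sub_right_eq_self (μ := μ) f y]

lemma integrableOn_inv_sq_add_sq {s : ℝ} (hs : 0 < s) :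
    IntegrableOn (fun t : ℝ ↦ (s ^ 2 + t ^ 2)⁻¹) (Set.Ioi 0) := by
  have h := (integrable_inv_one_add_sq.comp_mul_left' (inv_ne_zero hs.ne')).const_mul (s ^ 2)⁻¹
  refine (h.congr (.of_forall fun t ↦ ?_)).integrableOn
  simp only
  field_simp

lemma integral_Ioi_inv_sq_add_sq {s : ℝ} (hs : 0 < s) :
    ∫ t in Set.Ioi (0 : ℝ), (s ^ 2 + t ^ 2)⁻¹ = Real.pi / (2 * s) := by
  have h := integral_comp_mul_left_Ioi (fun t : ℝ ↦ (1 + t ^ 2)⁻¹) 0 (inv_pos.2 hs)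
  have hcongr : ∀ t : ℝ, (s ^ 2 + t ^ 2)⁻¹ = (s ^ 2)⁻¹ * (1 + (s⁻¹ * t) ^ 2)⁻¹ := fun t ↦ by
    field_simp
  simp only [hcongr, integral_const_mul, h, mul_zero, integral_Ioi_inv_one_add_sq, inv_inv,
    smul_eq_mul, Real.arctan_zero, sub_zero]
  field_simp

lemma lintegral_inv_norm_sq_mul_sq_add_norm_sq {s : ℝ} (hs : 0 < s) :
    ∫⁻ x : EuclideanSpace ℝ (Fin 3), ENNReal.ofReal (‖x‖ ^ 2 * (s ^ 2 + ‖x‖ ^ 2))⁻¹ =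
      ENNReal.ofReal (3 * volume.real (Metric.ball (0 : EuclideanSpace ℝ (Fin 3)) 1) *
        (Real.pi / (2 * s))) := by
  have hcongr : Set.EqOn
      (fun t : ℝ ↦ t ^ (Module.finrank ℝ (EuclideanSpace ℝ (Fin 3)) - 1) •
        (t ^ 2 * (s ^ 2 + t ^ 2))⁻¹)
      (fun t ↦ (s ^ 2 + t ^ 2)⁻¹) (Set.Ioi 0) := fun t (ht : 0 < t) ↦ by
    simp only [finrank_euclideanSpace_fin, smul_eq_mul, Nat.add_one_sub_one]
    field_simp
  rw [← ofReal_integral_eq_lintegral_ofReal, integral_fun_norm_addHaar volume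
      (fun t : ℝ ↦ (t ^ 2 * (s ^ 2 + t ^ 2))⁻¹), setIntegral_congr_fun measurableSet_Ioi hcongr,
    integral_Ioi_inv_sq_add_sq hs]
  · simp [mul_assoc]
  · rw [integrable_fun_norm_addHaar volume (f := fun t : ℝ ↦ (t ^ 2 * (s ^ 2 + t ^ 2))⁻¹),
      integrableOn_congr_fun hcongr measurableSet_Ioi]
    exact integrableOn_inv_sq_add_sq hs
  · exact .of_forall fun x ↦ by positivity

lemma inv_mul_le_of_two_mul_sq_le_add {a b s : ℝ} (ha : 0 ≤ a) (hb : 0 ≤ b) (hs : 0 < s)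
    (h : 2 * s ^ 2 ≤ a + b) :
    (a * b)⁻¹ ≤ 2 * (a * (s ^ 2 + a))⁻¹ + 2 * (b * (s ^ 2 + b))⁻¹ := by
  rcases ha.eq_or_lt with rfl | ha
  · rw [zero_mul, _root_.inv_zero]
    positivity
  rcases hb.eq_or_lt with rfl | hb
  · rw [mul_zero, _root_.inv_zero]
    positivity
  have hs2 : 0 < s ^ 2 := by positivity
  calc (a * b)⁻¹ = a⁻¹ * (a + b)⁻¹ + b⁻¹ * (a + b)⁻¹ := by field_simp; ring
    _ ≤ a⁻¹ * ((s ^ 2 + a) / 2)⁻¹ + b⁻¹ * ((s ^ 2 + b) / 2)⁻¹ := by gcongr <;> linarith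
    _ = 2 * (a * (s ^ 2 + a))⁻¹ + 2 * (b * (s ^ 2 + b))⁻¹ := by field_simp

/-- The convolution of `‖·‖⁻²` with itself on `ℝ³` is bounded by a multiple of `‖·‖⁻¹`. -/
lemma lintegral_inv_norm_sub_mul_norm_sq_le {x : EuclideanSpace ℝ (Fin 3)} (hx : x ≠ 0) :
    ∫⁻ y, ENNReal.ofReal (‖x - y‖ * ‖y‖)⁻¹ ^ 2 ≤
      ENNReal.ofReal (12 * volume.real (Metric.ball (0 : EuclideanSpace ℝ (Fin 3)) 1) * Real.pi /
        ‖x‖) := by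
  have hx' : 0 < ‖x‖ := norm_pos_iff.2 hx
  let ψ : EuclideanSpace ℝ (Fin 3) → ℝ≥0∞ := fun y ↦
    ENNReal.ofReal (‖y‖ ^ 2 * ((‖x‖ / 2) ^ 2 + ‖y‖ ^ 2))⁻¹
  have hψ : Measurable ψ := by fun_prop
  have hle : ∀ y, ENNReal.ofReal (‖x - y‖ * ‖y‖)⁻¹ ^ 2 ≤ 2 * ψ (x - y) + 2 * ψ y := fun y ↦ by
    have htri : ‖x‖ ≤ ‖x - y‖ + ‖y‖ := by simpa using norm_add_le (x - y) y
    have hsum : 2 * (‖x‖ / 2) ^ 2 ≤ ‖x - y‖ ^ 2 + ‖y‖ ^ 2 := by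
      nlinarith [sq_nonneg (‖x - y‖ - ‖y‖), norm_nonneg (x - y), norm_nonneg y]
    have h := inv_mul_le_of_two_mul_sq_le_add (sq_nonneg _) (sq_nonneg _) (half_pos hx') hsum
    rw [← ENNReal.ofReal_pow (by positivity), inv_pow, mul_pow]
    refine (ENNReal.ofReal_le_ofReal h).trans_eq ?_
    rw [ENNReal.ofReal_add (by positivity) (by positivity), ENNReal.ofReal_mul zero_le_two,
      ENNReal.ofReal_mul zero_le_two, ENNReal.ofReal_ofNat]
  calc ∫⁻ y, ENNReal.ofReal (‖x - y‖ * ‖y‖)⁻¹ ^ 2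
      ≤ ∫⁻ y, (2 * ψ (x - y) + 2 * ψ y) := lintegral_mono hle
    _ = 4 * ∫⁻ y, ψ y := by
        rw [lintegral_add_right _ (by fun_prop), lintegral_const_mul _ (by fun_prop),
          lintegral_const_mul _ hψ, lintegral_sub_left_eq_self ψ x, ← add_mul]
        norm_num
    _ = _ := by
        rw [lintegral_inv_norm_sq_mul_sq_add_norm_sq (half_pos hx'), ← ENNReal.ofReal_ofNat 4,
          ← ENNReal.ofReal_mul (by norm_num)]
        congr 1
        field_simp
        ring

/-- Product law `Ḣ¹ × Ḣ¹ → Ḣ^{1/2}` in `ℝ³`, Fourier-convolution form. -/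
theorem product_law_H1_H1_Hhalf :
    ∃ C > 0, ∀ F G : EuclideanSpace ℝ (Fin 3) → ℝ≥0∞,
      Measurable F → Measurable G →
      (∫⁻ ξ, ENNReal.ofReal ‖ξ‖ * (∫⁻ η, F (ξ - η) * G η) ^ 2) ≤
        ENNReal.ofReal C *
          ((∫⁻ ξ, ENNReal.ofReal (‖ξ‖ ^ 2) * F ξ ^ 2) *
            ∫⁻ ξ, ENNReal.ofReal (‖ξ‖ ^ 2) * G ξ ^ 2) := by
  set v := volume.real (Metric.ball (0 : EuclideanSpace ℝ (Fin 3)) 1)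
  have hv_pos : 0 < v :=
    ENNReal.toReal_pos (Metric.measure_ball_pos _ _ one_pos).ne' measure_ball_lt_top.ne
  refine ⟨12 * v * Real.pi, by positivity, fun F G hF hG ↦ ?_⟩
  let f : EuclideanSpace ℝ (Fin 3) → ℝ≥0∞ := fun ξ ↦ ENNReal.ofReal (‖ξ‖ ^ 2) * F ξ ^ 2
  let g : EuclideanSpace ℝ (Fin 3) → ℝ≥0∞ := fun ξ ↦ ENNReal.ofReal (‖ξ‖ ^ 2) * G ξ ^ 2
  have hf : Measurable f := by fun_prop
  have hg : Measurable g := by fun_prop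
  have key : ∀ ξ, ENNReal.ofReal ‖ξ‖ * (∫⁻ η, F (ξ - η) * G η) ^ 2 ≤
      ENNReal.ofReal (12 * v * Real.pi) * ∫⁻ η, f (ξ - η) * g η := fun ξ ↦ by
    rcases eq_or_ne ξ 0 with rfl | hξ
    · simp
    have hξ' : 0 < ‖ξ‖ := norm_pos_iff.2 hξ
    have hcongr : ∀ᵐ η, F (ξ - η) * G η =
        (ENNReal.ofReal (‖ξ - η‖ * ‖η‖) * (F (ξ - η) * G η)) *
          ENNReal.ofReal (‖ξ - η‖ * ‖η‖)⁻¹ := by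
      filter_upwards [Measure.ae_ne volume (0 : EuclideanSpace ℝ (Fin 3)),
        Measure.ae_ne volume ξ] with η h0 h1
      have h2 : 0 < ‖ξ - η‖ * ‖η‖ :=
        mul_pos (norm_pos_iff.2 (sub_ne_zero.2 h1.symm)) (norm_pos_iff.2 h0)
      rw [mul_right_comm, ← ENNReal.ofReal_mul h2.le, mul_inv_cancel₀ h2.ne', ENNReal.ofReal_one,
        one_mul]
    have hsq : ∀ η, (ENNReal.ofReal (‖ξ - η‖ * ‖η‖) * (F (ξ - η) * G η)) ^ 2 =
        f (ξ - η) * g η := fun η ↦ by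
      simp only [f, g]
      rw [mul_pow, mul_pow, ENNReal.ofReal_mul (norm_nonneg _), mul_pow,
        ENNReal.ofReal_pow (norm_nonneg _), ENNReal.ofReal_pow (norm_nonneg _)]
      ring
    calc ENNReal.ofReal ‖ξ‖ * (∫⁻ η, F (ξ - η) * G η) ^ 2
        ≤ ENNReal.ofReal ‖ξ‖ * ((∫⁻ η, f (ξ - η) * g η) *
            ENNReal.ofReal (12 * v * Real.pi / ‖ξ‖)) := by
          rw [lintegral_congr_ae hcongr]
          gcongr
          refine (sq_lintegral_mul_le (by fun_prop) (by fun_prop)).trans ?_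
          simp only [hsq]
          gcongr
          exact lintegral_inv_norm_sub_mul_norm_sq_le hξ
      _ = ENNReal.ofReal (12 * v * Real.pi) * ∫⁻ η, f (ξ - η) * g η := by
          rw [mul_left_comm, ← ENNReal.ofReal_mul hξ'.le, mul_div_cancel₀ _ hξ'.ne', mul_comm]
  calc _ ≤ ∫⁻ ξ, ENNReal.ofReal (12 * v * Real.pi) * ∫⁻ η, f (ξ - η) * g η := lintegral_mono key
    _ = _ := by
      rw [lintegral_const_mul' _ _ ENNReal.ofReal_ne_top, lintegral_lintegral_sub_mul hf hg]
end
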